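/- arXiv:2412.03170 — 5 statements merged into one kernel-verified Lean document; each statement's English description precedes it below -/
import Mathlib

section
/- Let n ≥ 3 be an integer and c > 0. If τ > 0 satisfies τ^{2n−3} > c/(2n−4) (equivalently τ > ((2n−4)/c)^{1/(3−2n)}), then the point (τ, τ, c·τ^{4−2n}) of the curve I₃ belongs to R₊. -/
/-- Principal Ricci curvature `r₁` of the invariant metric `(x1,x2,x3)` on `SO(n)/SO(n-2)`. -/
noncomputable def r1 (n : ℕ) (x1 x2 x3 : ℝ) : ℝ :=
  1/(2*x1) - (1/(4*((n:ℝ)-2))) * (x3/(x1*x2) + x2/(x1*x3) - x1/(x2*x3))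

/-- Principal Ricci curvature `r₂`. -/
noncomputable def r2 (n : ℕ) (x1 x2 x3 : ℝ) : ℝ :=
  1/(2*x2) - (1/(4*((n:ℝ)-2))) * (x3/(x1*x2) + x1/(x2*x3) - x2/(x1*x3))

/-- Principal Ricci curvature `r₃` (independent of `n`). -/
noncomputable def r3 (x1 x2 x3 : ℝ) : ℝ :=
  1/(2*x3) - (1/4) * (x1/(x2*x3) + x2/(x1*x3) - x3/(x1*x2))

/-- The set `R₊` of invariant metrics with positive Ricci curvature. -/
def Rpos (n : ℕ) (x1 x2 x3 : ℝ) : Prop :=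
  0 < x1 ∧ 0 < x2 ∧ 0 < x3 ∧
    0 < r1 n x1 x2 x3 ∧ 0 < r2 n x1 x2 x3 ∧ 0 < r3 x1 x2 x3

/-- First component of the normalized Ricci flow vector field on `SO(n)/SO(n-2)`. -/
noncomputable def f1 (n : ℕ) (x1 x2 x3 : ℝ) : ℝ :=
  (((n:ℝ)-1)*(x3^2+x2^2) - (3*(n:ℝ)-5)*x1^2
    - 2*((n:ℝ)-2)*(x1*x2 + ((n:ℝ)-2)*x3*x1 - ((n:ℝ)-1)*x3*x2))
    / (2*((n:ℝ)-2)*(2*(n:ℝ)-3)*x2*x3)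

/-- Second component of the normalized Ricci flow vector field. -/
noncomputable def f2 (n : ℕ) (x1 x2 x3 : ℝ) : ℝ :=
  (((n:ℝ)-1)*(x3^2+x1^2) - (3*(n:ℝ)-5)*x2^2
    - 2*((n:ℝ)-2)*(x1*x2 + ((n:ℝ)-2)*x3*x2 - ((n:ℝ)-1)*x3*x1))
    / (2*((n:ℝ)-2)*(2*(n:ℝ)-3)*x1*x3)

/-- Third component of the normalized Ricci flow vector field. -/
noncomputable def f3 (n : ℕ) (x1 x2 x3 : ℝ) : ℝ :=
  (((n:ℝ)-2)*(x1-x2)^2 + ((n:ℝ)-2)*(x1+x2)*x3 - ((n:ℝ)-1)*x3^2)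
    / ((2*(n:ℝ)-3)*x1*x2)

theorem r1_diag (n : ℕ) {x y : ℝ} (hn : 0 < (n:ℝ) - 2) (hx : 0 < x) (hy : 0 < y) :
    r1 n x x y = (2 * ((n:ℝ) - 2) * x - y) / (4 * ((n:ℝ) - 2) * x ^ 2) := by
  unfold r1
  field_simp
  ring

theorem r2_diag (n : ℕ) (x y : ℝ) : r2 n x x y = r1 n x x y := rfl

theorem r3_diag {x y : ℝ} (hx : 0 < x) (hy : 0 < y) : r3 x x y = y / (4 * x ^ 2) := by
  unfold r3
  field_simp
  ring

/-- A metric `(x, x, y)` has positive Ricci curvature as soon as `y < 2 (n - 2) x`. -/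
theorem Rpos_diag (n : ℕ) {x y : ℝ} (hn : 0 < (n:ℝ) - 2) (hx : 0 < x) (hy : 0 < y)
    (hxy : y < 2 * ((n:ℝ) - 2) * x) : Rpos n x x y := by
  have h1 : 0 < r1 n x x y := by
    rw [r1_diag n hn hx hy]
    exact div_pos (sub_pos.2 hxy) (by positivity)
  refine ⟨hx, hx, hy, h1, (r2_diag n x y).symm ▸ h1, ?_⟩
  rw [r3_diag hx hy]
  positivity

/-- For `τ^(2n-3) > c/(2n-4)`, the point `(τ, τ, c τ^(4-2n))` of the curve `I₃` lies in `R₊`. -/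
theorem stmt_5 (n : ℕ) (hn : 3 ≤ n) (c : ℝ) (hc : 0 < c) (τ : ℝ) (hτ : 0 < τ)
    (h : c/(2*(n:ℝ)-4) < τ ^ (2*n-3)) :
    Rpos n τ τ (c * τ ^ ((4:ℤ) - 2*(n:ℤ))) := by
  have hn' : 0 < (n:ℝ) - 2 := by
    have : (3:ℝ) ≤ n := by exact_mod_cast hn
    linarith
  have hz : 0 < τ ^ ((4:ℤ) - 2*(n:ℤ)) := zpow_pos hτ _
  refine Rpos_diag n hn' hτ (mul_pos hc hz) ?_
  have hmul : τ ^ (2*n-3) * τ ^ ((4:ℤ) - 2*(n:ℤ)) = τ := by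
    rw [← zpow_natCast, ← zpow_add₀ hτ.ne',
      show ((2*n-3 : ℕ) : ℤ) + ((4:ℤ) - 2*(n:ℤ)) = 1 by omega, zpow_one]
  rw [div_lt_iff₀ (by linarith)] at h
  calc c * τ ^ ((4:ℤ) - 2*(n:ℤ))
      < τ ^ (2*n-3) * (2*(n:ℝ)-4) * τ ^ ((4:ℤ) - 2*(n:ℤ)) := mul_lt_mul_of_pos_right h hz
    _ = 2 * ((n:ℝ) - 2) * (τ ^ (2*n-3) * τ ^ ((4:ℤ) - 2*(n:ℤ))) := by ring
    _ = 2 * ((n:ℝ) - 2) * τ := by rw [hmul]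
end

section
/- Let n ≥ 4 be an integer and define the quartic polynomial p(ν) = 4(n−2)³·ν⁴ − 2(n−2)(5n³−31n²+67n−49)·ν³ + (n⁶−6n⁵−5n⁴+136n³−453n²+630n−327)·ν² − 2(n−2)(5n³−31n²+67n−49)·ν + 4(n−2)³. Then p(ν) > 0 for every real ν ∈ [0, 1]; in particular p(ν) > 0 for all ν ∈ (0, 1/(2n−4)]. -/
/-- A palindromic quartic is positive when its associated quadratic in `x + x⁻¹` has positive
leading coefficient and negative discriminant. -/
lemma palindromic_quartic_pos {a b c : ℝ} (ha : 0 < a) (hD : 0 < 4 * a * (c - 2 * a) - b ^ 2)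
    (x : ℝ) : 0 < a * x ^ 4 - b * x ^ 3 + c * x ^ 2 - b * x + a := by
  rcases eq_or_ne x 0 with rfl | hx
  · simpa using ha
  · have h : 0 < 4 * a * (a * x ^ 4 - b * x ^ 3 + c * x ^ 2 - b * x + a) := by
      have hsq : 4 * a * (a * x ^ 4 - b * x ^ 3 + c * x ^ 2 - b * x + a)
          = (2 * a * (x ^ 2 + 1) - b * x) ^ 2 + (4 * a * (c - 2 * a) - b ^ 2) * x ^ 2 := by ring
      rw [hsq]
      positivity
    exact pos_of_mul_pos_right h (by positivity)

/-- The quartic `p(ν)` arising in the proof of Lemma 2 is positive on `[0,1]`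
(in particular on `(0, 1/(2n-4)]`) for every integer `n ≥ 4`. -/
theorem stmt_13 (n : ℕ) (hn : 4 ≤ n) (ν : ℝ) (hν : ν ∈ Set.Icc (0:ℝ) 1) :
    0 < 4*((n:ℝ)-2)^3*ν^4
        - 2*((n:ℝ)-2)*(5*(n:ℝ)^3-31*(n:ℝ)^2+67*(n:ℝ)-49)*ν^3
        + ((n:ℝ)^6-6*(n:ℝ)^5-5*(n:ℝ)^4+136*(n:ℝ)^3-453*(n:ℝ)^2+630*(n:ℝ)-327)*ν^2
        - 2*((n:ℝ)-2)*(5*(n:ℝ)^3-31*(n:ℝ)^2+67*(n:ℝ)-49)*ν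
        + 4*((n:ℝ)-2)^3 := by
  obtain ⟨k, rfl⟩ := Nat.exists_eq_add_of_le hn
  have hk : (0 : ℝ) ≤ k := k.cast_nonneg
  push_cast
  apply palindromic_quartic_pos
  · have h : (4 : ℝ) + k - 2 = k + 2 := by ring
    rw [h]
    positivity
  · ring_nf
    positivity
end

section
/- Let n ≥ 4 be an integer and let ν be real with 0 < ν ≤ 1/(2n−4). Define F(ν) = −(n−1)(n−2−ν)((n−2)ν−1) and G(ν) = (n−2)(n−3)(ν+1)·√(ν²−2(n−2)ν+1). Then F(ν) > 0, G(ν) > 0, and F(ν) > G(ν). -/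
/-- For `n ≥ 4` and `0 < ν ≤ 1/(2n-4)`:
`F(ν) = -(n-1)(n-2-ν)((n-2)ν-1) > 0`, `G(ν) = (n-2)(n-3)(ν+1)√(ν²-2(n-2)ν+1) > 0`, and
`F(ν) > G(ν)`. -/
theorem stmt_14 (n : ℕ) (hn : 4 ≤ n) (ν : ℝ) (h1 : 0 < ν) (h2 : ν ≤ 1/(2*(n:ℝ)-4)) :
    let F : ℝ := -((n:ℝ)-1)*((n:ℝ)-2-ν)*(((n:ℝ)-2)*ν-1)
    let G : ℝ := ((n:ℝ)-2)*((n:ℝ)-3)*(ν+1)*Real.sqrt (ν^2-2*((n:ℝ)-2)*ν+1)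
    0 < F ∧ 0 < G ∧ G < F := by
  have hm : (2:ℝ) ≤ (n:ℝ) - 2 := by
    have : (4:ℝ) ≤ n := by exact_mod_cast hn
    linarith
  obtain ⟨m, hmn⟩ : ∃ m : ℝ, m = (n:ℝ) - 2 := ⟨_, rfl⟩
  have hn' : (n:ℝ) = m + 2 := by linarith
  rw [hn'] at h2 hm ⊢
  replace hm : 2 ≤ m := by linarith
  have hmν : m * ν ≤ 1 / 2 := by
    rw [le_div_iff₀ (by linarith)] at h2
    linarith
  have hmν2 : 2 * ν ≤ m * ν := by gcongr
  have hrad : 0 < ν ^ 2 - 2 * m * ν + 1 := by nlinarith [sq_pos_of_pos h1]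
  have hsqrt : √(ν ^ 2 - 2 * m * ν + 1) ≤ 1 - m * ν := by
    apply Real.sqrt_le_iff.mpr
    constructor
    · linarith
    · nlinarith [mul_le_mul hmν2 hmν2 (by positivity) (by positivity)]
  have hcoef : m * (m - 1) * (ν + 1) < (m + 1) * (m - ν) := by nlinarith
  have e₁ : m + 2 - 2 = m := by ring
  have e₂ : m + 2 - 3 = m - 1 := by ring
  have e₃ : m + 2 - 1 = m + 1 := by ring
  rw [e₁, e₂, e₃]
  have hF : -(m + 1) * (m - ν) * (m * ν - 1) = (m + 1) * (m - ν) * (1 - m * ν) := by ring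
  have hlin : 0 < 1 - m * ν := by linarith
  have hm1 : 0 < m - 1 := by linarith
  have hmν' : 0 < m - ν := by linarith
  intro F G
  refine ⟨?_, ?_, ?_⟩
  · simp only [F, hF]
    positivity
  · have := Real.sqrt_pos.mpr hrad
    positivity
  · simp only [F, G, hF]
    calc m * (m - 1) * (ν + 1) * √(ν ^ 2 - 2 * m * ν + 1)
        ≤ m * (m - 1) * (ν + 1) * (1 - m * ν) := by gcongr
      _ < (m + 1) * (m - ν) * (1 - m * ν) := by gcongr
end

section
/- Let n ≥ 3 be an integer and x1, x2, x3 > 0. If x1² − x2² − x3² + 2(n−2)x2x3 = 0 and x1² − x2² + x3² − 2(n−2)x1x3 = 0 (the equations of the cones r₁ = 0 and r₂ = 0), then x3 = (n−2)(x1 + x2); if moreover n ≥ 4, then additionally x1 = x2, so the intersection of the two cones in the open positive octant is the straight line L = {(p, p, 2(n−2)p) : p > 0}. -/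
/-- If `x1, x2, x3 > 0` satisfy the equations of the cones `r₁ = 0` and `r₂ = 0`, then
`x3 = (n-2)(x1+x2)`; if moreover `n ≥ 4` then `x1 = x2`, so the intersection of the two cones
in the positive octant is the line `L = {(p, p, 2(n-2)p) : p > 0}`. -/
theorem stmt_16 (n : ℕ) (hn : 3 ≤ n) (x1 x2 x3 : ℝ)
    (h1 : 0 < x1) (h2 : 0 < x2) (h3 : 0 < x3)
    (e1 : x1^2 - x2^2 - x3^2 + 2*((n:ℝ)-2)*x2*x3 = 0)
    (e2 : x1^2 - x2^2 + x3^2 - 2*((n:ℝ)-2)*x1*x3 = 0) :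
    x3 = ((n:ℝ)-2)*(x1+x2) ∧ (4 ≤ n → x1 = x2) := by
  have h : x3 = ((n:ℝ)-2)*(x1+x2) := mul_left_cancel₀ h3.ne' (by linarith)
  refine ⟨h, fun hn4 => ?_⟩
  have hn4' : (4:ℝ) ≤ n := by exact_mod_cast hn4
  have hprod : (x1 - x2) * ((x1 + x2) * (1 - ((n:ℝ)-2)^2)) = 0 := by
    subst h
    linarith
  have hne : (x1 + x2) * (1 - ((n:ℝ)-2)^2) ≠ 0 :=
    mul_ne_zero (by positivity) (by nlinarith)
  exact sub_eq_zero.mp ((mul_eq_zero.mp hprod).resolve_right hne)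
end

section
/- Let n ≥ 3 be an integer and c > 0. Along the curve I₂ = {(τ, c^{1/(n−2)}·τ^{(1−n)/(n−2)}, τ) : τ > 0}, both the principal Ricci curvature r1 and the plane function −x1 + x2 + x3 tend to 0 as τ → +∞: lim_{τ→+∞} r1(τ, c^{1/(n−2)}τ^{(1−n)/(n−2)}, τ) = 0 and lim_{τ→+∞} [−τ + c^{1/(n−2)}τ^{(1−n)/(n−2)} + τ] = 0. (This shows that the boundary curves π₁ = Σ ∩ Π₁ and γ₁ = Σ ∩ Γ̃₁ of the set Σ ∩ R₊ approach each other arbitrarily closely at infinity.) -/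
/-- Along the curve `I₂ = {(τ, c^(1/(n-2)) τ^((1-n)/(n-2)), τ)}` both `r₁` and the plane
function `-x1 + x2 + x3` tend to `0` as `τ → +∞`. -/
theorem stmt_19 (n : ℕ) (hn : 3 ≤ n) (c : ℝ) (hc : 0 < c) :
    Filter.Tendsto
      (fun τ : ℝ =>
        r1 n τ (c ^ ((1:ℝ)/((n:ℝ)-2)) * τ ^ (((1:ℝ)-(n:ℝ))/((n:ℝ)-2))) τ)
      Filter.atTop (nhds 0) ∧
    Filter.Tendsto
      (fun τ : ℝ =>
        -τ + c ^ ((1:ℝ)/((n:ℝ)-2)) * τ ^ (((1:ℝ)-(n:ℝ))/((n:ℝ)-2)) + τ)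
      Filter.atTop (nhds 0) := by
  have hn' : (3 : ℝ) ≤ n := by exact_mod_cast hn
  have hb : Filter.Tendsto
      (fun τ : ℝ => c ^ ((1:ℝ)/((n:ℝ)-2)) * τ ^ (((1:ℝ)-(n:ℝ))/((n:ℝ)-2)))
      Filter.atTop (nhds 0) := by
    have hexp : 0 < ((n:ℝ)-1)/((n:ℝ)-2) := div_pos (by linarith) (by linarith)
    have h := (tendsto_rpow_neg_atTop hexp).const_mul (c ^ ((1:ℝ)/((n:ℝ)-2)))
    rwa [mul_zero, ← neg_div, neg_sub] at h
  refine ⟨?_, by simpa using hb⟩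
  have hinv : Filter.Tendsto (fun τ : ℝ => τ⁻¹) Filter.atTop (nhds 0) :=
    tendsto_inv_atTop_zero
  have h := (hinv.const_mul (1/2)).sub
    (((hb.mul hinv).mul hinv).const_mul (1/(4*((n:ℝ)-2))))
  simp only [mul_zero, sub_zero] at h
  refine h.congr fun τ => ?_
  simp only [r1, div_eq_mul_inv, mul_inv]
  ring
end
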